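/- Let φ(u,z) = θ(u+z)θ'(0)/(θ(u)θ(z)) and E₂(z) = −∂_z E₁(z) = −∂_z² log θ(z), with θ the odd Jacobi theta function, Im τ > 0. Then φ(u,z)·φ(−u,z) = E₂(z) − E₂(u), wherever defined. -/

import Mathlib

open Complex

/-- The odd Jacobi theta function
`θ(z|τ) = q^{1/8} ∑_{n∈ℤ} (−1)^n e^{πi(n(n+1)τ + 2nz)}` with `q = e^{2πiτ}`. -/
noncomputable def jTheta (τ z : ℂ) : ℂ :=
  Complex.exp ((Real.pi : ℂ) * I * τ / 4) *
    ∑' n : ℤ, (-1 : ℂ) ^ n *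
      Complex.exp ((Real.pi : ℂ) * I * ((n : ℂ) * ((n : ℂ) + 1) * τ + 2 * (n : ℂ) * z))

/-- The Kronecker elliptic function `φ(u,z) = θ(u+z)θ'(0)/(θ(u)θ(z))`. -/
noncomputable def kron (τ u z : ℂ) : ℂ :=
  jTheta τ (u + z) * deriv (jTheta τ) 0 / (jTheta τ u * jTheta τ z)

/-- The first Eisenstein function `E₁(z) = ∂_z log θ(z) = θ'(z)/θ(z)`. -/
noncomputable def eisE₁ (τ z : ℂ) : ℂ := deriv (jTheta τ) z / jTheta τ z

/-- The second Eisenstein function `E₂(z) = −∂_z E₁(z) = −∂_z² log θ(z)`. -/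
noncomputable def eisE₂ (τ z : ℂ) : ℂ := -deriv (eisE₁ τ) z

/-- Reindexing of pairs of integers by parity of their sum. -/
def parMap : (ℤ × ℤ) ⊕ (ℤ × ℤ) → ℤ × ℤ
  | Sum.inl p => (p.1 + p.2, p.1 - p.2)
  | Sum.inr p => (p.1 + p.2 + 1, p.1 - p.2)

lemma parMap_bij : Function.Bijective parMap := by
  constructor
  · rintro (⟨a, b⟩ | ⟨a, b⟩) (⟨c, d⟩ | ⟨c, d⟩) h <;> simp only [parMap, Prod.mk.injEq] at h
    · obtain ⟨rfl, rfl⟩ : a = c ∧ b = d := by omega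
      rfl
    · omega
    · omega
    · obtain ⟨rfl, rfl⟩ : a = c ∧ b = d := by omega
      rfl
  · rintro ⟨m, n⟩
    rcases Int.emod_two_eq_zero_or_one (m + n) with h | h
    · refine ⟨Sum.inl ((m + n) / 2, (m - n) / 2), ?_⟩
      simp only [parMap, Prod.mk.injEq]
      omega
    · refine ⟨Sum.inr ((m + n - 1) / 2, (m - n - 1) / 2), ?_⟩
      simp only [parMap, Prod.mk.injEq]
      omega

lemma theta_prod_hasSum (p q τ : ℂ) (hτ : 0 < τ.im) :
    HasSum (fun m : ℤ × ℤ => jacobiTheta₂_term m.1 p τ * jacobiTheta₂_term m.2 q τ)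
      (jacobiTheta₂ p τ * jacobiTheta₂ q τ) := by
  have h1 := (summable_jacobiTheta₂_term_iff p τ).2 hτ
  have h2 := (summable_jacobiTheta₂_term_iff q τ).2 hτ
  have h3 := summable_mul_of_summable_norm h1.norm h2.norm
  have h4 := tsum_mul_tsum_of_summable_norm h1.norm h2.norm
  unfold jacobiTheta₂
  rw [h4]
  exact h3.hasSum

lemma theta_mul (p q τ : ℂ) (hτ : 0 < τ.im) :
    jacobiTheta₂ p τ * jacobiTheta₂ q τ =
      jacobiTheta₂ (p + q) (2 * τ) * jacobiTheta₂ (p - q) (2 * τ) +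
      cexp (Real.pi * I * (τ + 2 * p)) *
        (jacobiTheta₂ (p + q + τ) (2 * τ) * jacobiTheta₂ (p - q + τ) (2 * τ)) := by
  have hτ2 : 0 < (2 * τ).im := by simpa using hτ
  have h0 := theta_prod_hasSum p q τ hτ
  rw [← (Equiv.ofBijective parMap parMap_bij).hasSum_iff] at h0
  refine h0.unique (HasSum.sum ?_ ?_)
  · convert theta_prod_hasSum (p + q) (p - q) (2 * τ) hτ2 using 1
    funext m
    simp only [Function.comp, Equiv.ofBijective_apply, parMap, jacobiTheta₂_term,
      ← Complex.exp_add]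
    push_cast
    congr 1
    ring
  · convert (theta_prod_hasSum (p + q + τ) (p - q + τ) (2 * τ) hτ2).mul_left
      (cexp (Real.pi * I * (τ + 2 * p))) using 1
    · rfl
    funext m
    simp only [Function.comp, Equiv.ofBijective_apply, parMap, jacobiTheta₂_term,
      ← Complex.exp_add]
    push_cast
    congr 1
    ring

lemma jTheta_eq (τ z : ℂ) : jTheta τ z =
    cexp (Real.pi * I * τ / 4) * jacobiTheta₂ (z + τ / 2 + 1 / 2) τ := by
  unfold jTheta jacobiTheta₂
  congr 1
  refine tsum_congr fun n => ?_
  have : (-1 : ℂ) ^ n = cexp (n * (Real.pi * I)) := by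
    rw [Complex.exp_int_mul, Complex.exp_pi_mul_I]
  rw [this, jacobiTheta₂_term, ← Complex.exp_add]
  congr 1
  ring

lemma jTheta_diff (τ : ℂ) (hτ : 0 < τ.im) : Differentiable ℂ (jTheta τ) := by
  have : jTheta τ = fun z => cexp (Real.pi * I * τ / 4) *
      jacobiTheta₂ (z + τ / 2 + 1 / 2) τ := funext (jTheta_eq τ)
  rw [this]
  intro z
  refine DifferentiableAt.const_mul ?_ _
  exact (differentiableAt_jacobiTheta₂_fst (z + τ / 2 + 1 / 2) hτ).comp
    (f := fun z => z + τ / 2 + 1 / 2) z (by fun_prop)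

lemma jTheta_neg (τ z : ℂ) : jTheta τ (-z) = - cexp (2 * Real.pi * I * z) * jTheta τ z := by
  rw [jTheta_eq, jTheta_eq, ← jacobiTheta₂_neg_left (-z + τ / 2 + 1 / 2)]
  have h := jacobiTheta₂_add_left' (z - τ / 2 + 1 / 2) τ
  have h1 := jacobiTheta₂_add_left (-(-z + τ / 2 + 1 / 2)) τ
  rw [← h1, show -(-z + τ / 2 + 1 / 2) + 1 = z - τ / 2 + 1 / 2 by ring]
  rw [show z + τ / 2 + 1 / 2 = z - τ / 2 + 1 / 2 + τ by ring, h]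
  have : cexp (2 * Real.pi * I * z) *
      cexp (-Real.pi * I * (τ + 2 * (z - τ / 2 + 1 / 2))) = -1 := by
    rw [← Complex.exp_add, ← Complex.exp_neg_pi_mul_I]
    congr 1
    ring
  linear_combination (cexp (Real.pi * I * τ / 4) * jacobiTheta₂ (z - τ / 2 + 1 / 2) τ) * this

/-- First auxiliary function of the addition formula. -/
noncomputable def thA (τ x : ℂ) : ℂ := jacobiTheta₂ (2 * x) (2 * τ)

/-- Second auxiliary function of the addition formula. -/
noncomputable def thB (τ x : ℂ) : ℂ :=
  cexp (2 * Real.pi * I * x) * jacobiTheta₂ (2 * x + τ) (2 * τ)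

lemma thA_diff (τ : ℂ) (hτ : 0 < τ.im) : Differentiable ℂ (thA τ) := by
  have hτ2 : 0 < (2 * τ).im := by simpa using hτ
  intro z
  exact (differentiableAt_jacobiTheta₂_fst (2 * z) hτ2).comp
    (f := fun z => 2 * z) z (by fun_prop)

lemma thB_diff (τ : ℂ) (hτ : 0 < τ.im) : Differentiable ℂ (thB τ) := by
  have hτ2 : 0 < (2 * τ).im := by simpa using hτ
  intro z
  refine DifferentiableAt.mul (by fun_prop) ?_
  exact (differentiableAt_jacobiTheta₂_fst (2 * z + τ) hτ2).comp
    (f := fun z => 2 * z + τ) z (by fun_prop)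

lemma jTheta_add_formula (τ x y : ℂ) (hτ : 0 < τ.im) :
    jTheta τ (x + y) * jTheta τ (x - y) =
      cexp (Real.pi * I * τ / 2) * cexp (-(2 * Real.pi * I * x)) *
        (thB τ x * thA τ y - thA τ x * thB τ y) := by
  have h := theta_mul (x + y + τ / 2 + 1 / 2) (x - y + τ / 2 + 1 / 2) τ hτ
  rw [jTheta_eq, jTheta_eq]
  rw [show x + y + τ / 2 + 1 / 2 + (x - y + τ / 2 + 1 / 2) + τ = 2 * x + 2 * τ + 1 by ring,
    show x + y + τ / 2 + 1 / 2 + (x - y + τ / 2 + 1 / 2) = 2 * x + τ + 1 by ring,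
    show x + y + τ / 2 + 1 / 2 - (x - y + τ / 2 + 1 / 2) = 2 * y by ring,
    jacobiTheta₂_add_left, jacobiTheta₂_add_left, jacobiTheta₂_add_left'] at h
  have e1 : cexp (Real.pi * I * τ / 4) * cexp (Real.pi * I * τ / 4) =
      cexp (Real.pi * I * τ / 2) := by
    rw [← Complex.exp_add]; congr 1; ring
  have e2 : cexp (Real.pi * I * (τ + 2 * (x + y + τ / 2 + 1 / 2))) *
      cexp (-Real.pi * I * (2 * τ + 2 * (2 * x))) =
      - (cexp (-(2 * Real.pi * I * x)) * cexp (2 * Real.pi * I * y)) := by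
    rw [← Complex.exp_add, ← Complex.exp_add,
      ← neg_one_mul (cexp (-(2 * Real.pi * I * x) + 2 * Real.pi * I * y)),
      ← Complex.exp_pi_mul_I, ← Complex.exp_add]
    congr 1
    ring
  have e3 : cexp (-(2 * Real.pi * I * x)) * cexp (2 * Real.pi * I * x) = 1 := by
    rw [← Complex.exp_add]; simp
  unfold thA thB
  rw [mul_mul_mul_comm, e1, h]
  linear_combination cexp (Real.pi * I * τ / 2) * (jacobiTheta₂ (2 * x) (2 * τ) *
    jacobiTheta₂ (2 * y + τ) (2 * τ) * e2 - jacobiTheta₂ (2 * x + τ) (2 * τ) *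
    jacobiTheta₂ (2 * y) (2 * τ) * e3)

lemma second_deriv_prod (f : ℂ → ℂ) (hf : Differentiable ℂ f) (x : ℂ) :
    deriv (deriv (fun y => f (x + y) * f (x - y))) 0 =
      2 * (deriv (deriv f) x * f x - deriv f x ^ 2) := by
  have hf' : Differentiable ℂ (deriv f) := hf.deriv
  have key : ∀ (g : ℂ → ℂ), Differentiable ℂ g → ∀ y,
      HasDerivAt (fun y => g (x + y)) (deriv g (x + y)) y ∧
      HasDerivAt (fun y => g (x - y)) (-deriv g (x - y)) y := by
    intro g hg y
    exact ⟨(hg (x + y)).hasDerivAt.comp_const_add x y,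
      (hg (x - y)).hasDerivAt.comp_const_sub x y⟩
  have h1 : deriv (fun y => f (x + y) * f (x - y)) =
      fun y => deriv f (x + y) * f (x - y) + f (x + y) * -deriv f (x - y) := by
    funext y
    exact ((key f hf y).1.mul (key f hf y).2).deriv
  rw [h1]
  have h2 := ((key _ hf' 0).1.mul (key f hf 0).2).add
    ((key f hf 0).1.mul (key _ hf' 0).2.neg)
  have h3 := h2.deriv
  refine Eq.trans h3 ?_
  simp only [add_zero, sub_zero, Pi.neg_apply]
  ring

lemma second_deriv_lin (f g : ℂ → ℂ) (hf : Differentiable ℂ f) (hg : Differentiable ℂ g)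
    (a b c : ℂ) : deriv (deriv (fun y => c * (a * f y - b * g y))) 0 =
      c * (a * deriv (deriv f) 0 - b * deriv (deriv g) 0) := by
  have key : ∀ (f g : ℂ → ℂ), Differentiable ℂ f → Differentiable ℂ g → ∀ y,
      deriv (fun y => c * (a * f y - b * g y)) y = c * (a * deriv f y - b * deriv g y) := by
    intro f g hf hg y
    exact ((((hf y).hasDerivAt.const_mul a).sub ((hg y).hasDerivAt.const_mul b)).const_mul
      c).deriv
  rw [funext (key f g hf hg), key _ _ hf.deriv hg.deriv]

lemma eisE₂_eq (τ z : ℂ) (hτ : 0 < τ.im) (hz : jTheta τ z ≠ 0) :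
    eisE₂ τ z = -((deriv (deriv (jTheta τ)) z * jTheta τ z - deriv (jTheta τ) z ^ 2) /
      jTheta τ z ^ 2) := by
  have hd := jTheta_diff τ hτ
  have := ((hd.deriv z).hasDerivAt.div (hd z).hasDerivAt hz).deriv
  unfold eisE₂
  congr 1
  refine Eq.trans this ?_
  ring

/-- `φ(u,z)·φ(−u,z) = E₂(z) − E₂(u)`, wherever defined. -/
theorem kron_product_eq_E₂_difference (τ u z : ℂ) (hτ : 0 < τ.im)
    (hu : jTheta τ u ≠ 0) (hz : jTheta τ z ≠ 0) :
    kron τ u z * kron τ (-u) z = eisE₂ τ z - eisE₂ τ u := by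
  have hd := jTheta_diff τ hτ
  have sq : ∀ x, jTheta τ x ^ 2 = cexp (Real.pi * I * τ / 2) * cexp (-(2 * Real.pi * I * x)) *
        (thB τ x * thA τ 0 - thA τ x * thB τ 0) := by
    intro x
    have := jTheta_add_formula τ x 0 hτ
    rw [add_zero, sub_zero] at this
    rw [sq, this]
  have dd : ∀ x, 2 * (deriv (deriv (jTheta τ)) x * jTheta τ x - deriv (jTheta τ) x ^ 2) =
      cexp (Real.pi * I * τ / 2) * cexp (-(2 * Real.pi * I * x)) *
        (thB τ x * deriv (deriv (thA τ)) 0 - thA τ x * deriv (deriv (thB τ)) 0) := by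
    intro x
    rw [← second_deriv_prod _ hd, funext fun y => jTheta_add_formula τ x y hτ,
      second_deriv_lin _ _ (thA_diff τ hτ) (thB_diff τ hτ)]
  have h0 : jTheta τ 0 = 0 := by
    have := jTheta_neg τ 0
    simp only [neg_zero, mul_zero, Complex.exp_zero] at this
    linear_combination this / 2
  have d0 := dd 0
  rw [h0] at d0
  simp only [mul_zero, neg_zero, Complex.exp_zero, mul_one] at d0
  have add := jTheta_add_formula τ z u hτ
  have sz := sq z
  have su := sq u
  have dz := dd z
  have du := dd u
  rw [eisE₂_eq τ z hτ hz, eisE₂_eq τ u hτ hu]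
  unfold kron
  rw [jTheta_neg, show u + z = z + u by ring, show -u + z = z - u by ring]
  have e3 : cexp (-(2 * Real.pi * I * u)) * cexp (2 * Real.pi * I * u) = 1 := by
    rw [← Complex.exp_add]; simp
  have hE := Complex.exp_ne_zero (2 * Real.pi * I * u)
  generalize cexp (2 * Real.pi * I * u) = E at *
  generalize cexp (-(2 * Real.pi * I * u)) = E' at *
  generalize cexp (-(2 * Real.pi * I * z)) = Z' at *
  generalize cexp (Real.pi * I * τ / 2) = K at *
  generalize thA τ z = Az at *
  generalize thB τ z = Bz at *
  generalize thA τ u = Au at *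
  generalize thB τ u = Bu at *
  generalize thA τ 0 = A0 at *
  generalize thB τ 0 = B0 at *
  generalize deriv (deriv (thA τ)) 0 = A2 at *
  generalize deriv (deriv (thB τ)) 0 = B2 at *
  generalize deriv (deriv (jTheta τ)) z = jzz at *
  generalize deriv (deriv (jTheta τ)) u = juu at *
  generalize deriv (jTheta τ) z = jz' at *
  generalize deriv (jTheta τ) u = ju' at *
  generalize deriv (jTheta τ) 0 = j0' at *
  generalize jTheta τ (z + u) = s at *
  generalize jTheta τ (z - u) = d at *
  generalize jTheta τ z = tz at *
  generalize jTheta τ u = tu at *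
  have main : s * d * j0' ^ 2 * E' =
      tu ^ 2 * (jzz * tz - jz' ^ 2) - tz ^ 2 * (juu * tu - ju' ^ 2) := by
    have a1 : jzz * tz - jz' ^ 2 = K * Z' * (Bz * A2 - Az * B2) / 2 := by
      linear_combination dz / 2
    have a2 : juu * tu - ju' ^ 2 = K * E' * (Bu * A2 - Au * B2) / 2 := by
      linear_combination du / 2
    have a3 : j0' ^ 2 = - K * (B0 * A2 - A0 * B2) / 2 := by
      linear_combination -d0 / 2
    rw [a1, a2, a3, su, sz, add]
    ring
  have hE' : E' = E⁻¹ := eq_inv_of_mul_eq_one_left e3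
  rw [hE'] at main
  field_simp at main ⊢
  linear_combination -main
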